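/- Every adjoint solution v : ℤ → sl_n (i.e. every function from ℤ to traceless n×n complex matrices satisfying k·v(k) + [N, v(k)] + [E, v(k−1)] = 0 for all k ∈ ℤ) satisfies v(k) = 0 for every k < 0. (This is the key step in the proof that the de Rham cohomology of the Frenkel–Gross connection with values in the adjoint representation vanishes, i.e. that the connection is rigid.) -/

import Mathlib

/-- Reduction of an integer modulo `n`, as an index. -/
def fgIdx (n : ℕ) (hn : 2 ≤ n) (x : ℤ) : Fin n :=
  ⟨(x % n).toNat, by
    have h1 := Int.emod_nonneg x (b := (n : ℤ)) (by omega)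
    have h2 := Int.emod_lt_of_pos x (b := (n : ℤ)) (by omega)
    omega⟩

/-- The periodic infinite matrix attached to a loop `v`. -/
def fgA (n : ℕ) (hn : 2 ≤ n) (v : ℤ → Matrix (Fin n) (Fin n) ℂ) (x y : ℤ) : ℂ :=
  v (x / n - y / n) (fgIdx n hn x) (fgIdx n hn y)

theorem fgIdx_eq (n : ℕ) (hn : 2 ≤ n) (q : ℤ) (i : Fin n) :
    fgIdx n hn (n * q + (i : ℕ)) = i := by
  apply Fin.ext
  simp only [fgIdx, Int.mul_add_emod_self_left]
  rw [Int.emod_eq_of_lt (by omega) (by omega)]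
  simp

theorem fgA_eq (n : ℕ) (hn : 2 ≤ n) (v : ℤ → Matrix (Fin n) (Fin n) ℂ) (q r : ℤ) (i j : Fin n) :
    fgA n hn v (n * q + (i : ℕ)) (n * r + (j : ℕ)) = v (q - r) i j := by
  have hd : ∀ (q : ℤ) (i : Fin n), (n * q + (i : ℕ) : ℤ) / n = q := by
    intro q i
    rw [Int.mul_add_ediv_left _ _ (by omega), Int.ediv_eq_zero_of_lt (by omega) (by omega)]
    simp
  rw [fgA, fgIdx_eq, fgIdx_eq, hd, hd]

theorem fg_decomp (n : ℕ) (hn : 2 ≤ n) (x : ℤ) :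
    ∃ (q : ℤ) (i : Fin n), x = n * q + (i : ℕ) ∧ x / n = q := by
  refine ⟨x / n, fgIdx n hn x, ?_, rfl⟩
  have h1 := Int.emod_nonneg x (b := (n : ℤ)) (by omega)
  have h2 := Int.mul_ediv_add_emod x n
  simp only [fgIdx]
  omega

/-- Periodicity. -/
theorem fgA_per (n : ℕ) (hn : 2 ≤ n) (v : ℤ → Matrix (Fin n) (Fin n) ℂ) (x y : ℤ) :
    fgA n hn v (x + n) (y + n) = fgA n hn v x y := by
  obtain ⟨q, i, rfl, -⟩ := fg_decomp n hn x
  obtain ⟨r, j, rfl, -⟩ := fg_decomp n hn y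
  rw [show (n * q + (i : ℕ) + n : ℤ) = n * (q + 1) + (i : ℕ) by ring,
    show (n * r + (j : ℕ) + n : ℤ) = n * (r + 1) + (j : ℕ) by ring, fgA_eq, fgA_eq]
  congr 1
  ring_nf

theorem fg_left (n : ℕ) (hn : 2 ≤ n)
    (N E : Matrix (Fin n) (Fin n) ℂ)
    (hNdef : ∀ i j : Fin n, N i j = if (i : ℕ) = (j : ℕ) + 1 then 1 else 0)
    (hEdef : ∀ i j : Fin n, E i j = if (i : ℕ) = 0 ∧ (j : ℕ) = n - 1 then 1 else 0)
    (v : ℤ → Matrix (Fin n) (Fin n) ℂ) (q r : ℤ) (i j : Fin n) :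
    (N * v (q - r)) i j + (E * v (q - r - 1)) i j
      = fgA n hn v (n * q + (i : ℕ) - 1) (n * r + (j : ℕ)) := by
  rw [Matrix.mul_apply, Matrix.mul_apply]
  simp only [hNdef, hEdef, ite_mul, one_mul, zero_mul]
  by_cases hi : (i : ℕ) = 0
  · rw [Finset.sum_eq_zero (fun l _ => if_neg (by omega)), zero_add,
      Finset.sum_eq_single (⟨n - 1, by omega⟩ : Fin n)]
    · rw [if_pos ⟨hi, rfl⟩]
      rw [show (n * q + (i : ℕ) - 1 : ℤ) = n * (q - 1) + ((⟨n - 1, by omega⟩ : Fin n) : ℕ) by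
        rw [hi]; push_cast [Nat.cast_sub (show 1 ≤ n by omega)]; ring, fgA_eq]
      congr 1
      ring_nf
    · intro l _ hl
      exact if_neg (fun h => hl (Fin.ext h.2))
    · simp
  · rw [add_comm, Finset.sum_eq_zero (fun l _ => if_neg (by omega)), zero_add,
      Finset.sum_eq_single (⟨i - 1, by omega⟩ : Fin n)]
    · rw [if_pos (by simp only []; omega)]
      rw [show (n * q + (i : ℕ) - 1 : ℤ) = n * q + ((⟨i - 1, by omega⟩ : Fin n) : ℕ) by
        push_cast [Nat.cast_sub (show 1 ≤ (i : ℕ) by omega)]; ring, fgA_eq]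
    · intro l _ hl
      exact if_neg (fun h => hl (Fin.ext (by simp only []; omega)))
    · simp

theorem fg_right (n : ℕ) (hn : 2 ≤ n)
    (N E : Matrix (Fin n) (Fin n) ℂ)
    (hNdef : ∀ i j : Fin n, N i j = if (i : ℕ) = (j : ℕ) + 1 then 1 else 0)
    (hEdef : ∀ i j : Fin n, E i j = if (i : ℕ) = 0 ∧ (j : ℕ) = n - 1 then 1 else 0)
    (v : ℤ → Matrix (Fin n) (Fin n) ℂ) (q r : ℤ) (i j : Fin n) :
    (v (q - r) * N) i j + (v (q - r - 1) * E) i j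
      = fgA n hn v (n * q + (i : ℕ)) (n * r + (j : ℕ) + 1) := by
  rw [Matrix.mul_apply, Matrix.mul_apply]
  simp only [hNdef, hEdef, mul_ite, mul_one, mul_zero]
  by_cases hj : (j : ℕ) = n - 1
  · rw [Finset.sum_eq_zero (fun l _ => if_neg (by omega)), zero_add,
      Finset.sum_eq_single (⟨0, by omega⟩ : Fin n)]
    · rw [if_pos ⟨rfl, hj⟩]
      rw [show (n * r + (j : ℕ) + 1 : ℤ) = n * (r + 1) + ((⟨0, by omega⟩ : Fin n) : ℕ) by
        rw [hj]; push_cast [Nat.cast_sub (show 1 ≤ n by omega)]; ring, fgA_eq]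
      congr 1
      ring_nf
    · intro l _ hl
      exact if_neg (fun h => hl (Fin.ext h.1))
    · simp
  · rw [add_comm, Finset.sum_eq_zero (fun l _ => if_neg (by omega)), zero_add,
      Finset.sum_eq_single (⟨j + 1, by omega⟩ : Fin n)]
    · rw [if_pos rfl]
      rw [show (n * r + (j : ℕ) + 1 : ℤ) = n * r + ((⟨j + 1, by omega⟩ : Fin n) : ℕ) by
        push_cast; ring, fgA_eq]
    · intro l _ hl
      exact if_neg (fun h => hl (Fin.ext h))
    · simp

/-- Rigidity of the Frenkel–Gross connection for the adjoint representation of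
SL_n: every doubly-infinite formal solution of the adjoint recursion
k·v(k) + [N, v(k)] + [E, v(k−1)] = 0 with values in traceless matrices has
vanishing coefficients in negative degrees. -/
theorem stmt_13 (n : ℕ) (hn : 2 ≤ n)
    (N E : Matrix (Fin n) (Fin n) ℂ)
    (hNdef : ∀ i j : Fin n, N i j = if (i : ℕ) = (j : ℕ) + 1 then 1 else 0)
    (hEdef : ∀ i j : Fin n, E i j = if (i : ℕ) = 0 ∧ (j : ℕ) = n - 1 then 1 else 0)
    (v : ℤ → Matrix (Fin n) (Fin n) ℂ)
    (htr : ∀ k : ℤ, (v k).trace = 0)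
    (hv : ∀ k : ℤ, (k : ℂ) • v k + (N * v k - v k * N) + (E * v (k - 1) - v (k - 1) * E) = 0) :
    ∀ k : ℤ, k < 0 → v k = 0 := by
  have key : ∀ x y : ℤ, ((x / n - y / n : ℤ) : ℂ) * fgA n hn v x y
      + fgA n hn v (x - 1) y - fgA n hn v x (y + 1) = 0 := by
    intro x y
    obtain ⟨q, i, hx, hq⟩ := fg_decomp n hn x
    obtain ⟨r, j, hy, hr⟩ := fg_decomp n hn y
    rw [hq, hr, hx, hy, fgA_eq, ← fg_left n hn N E hNdef hEdef, ← fg_right n hn N E hNdef hEdef]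
    have h := congrFun (congrFun (hv (q - r)) i) j
    simp only [Matrix.add_apply, Matrix.sub_apply, Matrix.smul_apply, smul_eq_mul,
      Matrix.zero_apply] at h
    linear_combination h
  have hn0 : (0 : ℤ) < n := by omega
  -- the principal degree `-m` part is zero for every `m ≥ 1`
  have main : ∀ m : ℕ, (∀ x : ℤ, ((x / n - (x + m) / n : ℤ) : ℂ) * fgA n hn v x (x + m) = 0) ∧
      (0 < m → ∀ x : ℤ, fgA n hn v x (x + m) = 0) := by
    intro m
    induction m with
    | zero => exact ⟨fun x => by simp, fun h => absurd h (by simp)⟩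
    | succ m ih =>
      have hstep : ∀ x : ℤ, fgA n hn v (x + 1) (x + 1 + (m + 1 : ℕ))
          = fgA n hn v x (x + (m + 1 : ℕ)) := by
        intro x
        have h1 := key (x + 1) (x + 1 + m)
        rw [ih.1 (x + 1)] at h1
        rw [show x + 1 - 1 = x by ring, show x + 1 + (m : ℤ) + 1 = x + 1 + (m + 1 : ℕ) by
          push_cast; ring, show x + 1 + (m : ℤ) = x + (m + 1 : ℕ) by push_cast; ring] at h1
        linear_combination -h1
      have hconst : ∀ x : ℤ, fgA n hn v x (x + (m + 1 : ℕ)) = fgA n hn v 0 (0 + (m + 1 : ℕ)) := by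
        intro x
        induction x using Int.induction_on with
        | zero => rfl
        | succ i hi => rw [hstep, hi]
        | pred i hi =>
          rw [← hi, ← hstep (-(i : ℤ) - 1)]
          rw [show -(i : ℤ) - 1 + 1 = -i by ring]
      set c := fgA n hn v 0 (0 + (m + 1 : ℕ)) with hc
      let F : ℕ → ℂ := fun x => fgA n hn v ((x : ℤ) - 1) (x + (m + 1 : ℕ))
      have hF : ∀ x : ℕ, F (x + 1) - F x
          = (((x : ℤ) / n - ((x : ℤ) + (m + 1 : ℕ)) / n : ℤ) : ℂ) * c := by
        intro x
        have h1 := key x (x + (m + 1 : ℕ))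
        rw [hconst] at h1
        simp only [F]
        rw [show ((x + 1 : ℕ) : ℤ) - 1 = x by push_cast; ring,
          show ((x + 1 : ℕ) : ℤ) + (m + 1 : ℕ) = x + (m + 1 : ℕ) + 1 by push_cast; ring]
        linear_combination -h1
      have hper : F n = F 0 := by
        simp only [F]
        rw [← fgA_per n hn v ((0 : ℕ) - 1 : ℤ)]
        congr 1 <;> push_cast <;> ring
      have hsum := Finset.sum_range_sub F n
      rw [hper, sub_self, Finset.sum_congr rfl (fun x _ => hF x), ← Finset.sum_mul,
        ← Int.cast_sum] at hsum
      have hneg : ∑ x ∈ Finset.range n, ((x : ℤ) / n - ((x : ℤ) + (m + 1 : ℕ)) / n : ℤ) < 0 := by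
        apply Finset.sum_neg'
        · intro x _
          have := Int.ediv_le_ediv hn0 (show (x : ℤ) ≤ x + (m + 1 : ℕ) by omega)
          omega
        · refine ⟨n - 1, Finset.mem_range.2 (by omega), ?_⟩
          have h1 : ((n - 1 : ℕ) : ℤ) / n = 0 := Int.ediv_eq_zero_of_lt (by omega) (by omega)
          have h2 : 1 ≤ (((n - 1 : ℕ) : ℤ) + (m + 1 : ℕ)) / n :=
            (Int.le_ediv_iff_mul_le hn0).2 (by omega)
          omega
      have hc0 : c = 0 := by
        rcases mul_eq_zero.1 hsum with h | h
        · exact absurd (Int.cast_eq_zero.1 h) hneg.ne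
        · exact h
      have hz : ∀ x : ℤ, fgA n hn v x (x + (m + 1 : ℕ)) = 0 := fun x => (hconst x).trans hc0
      exact ⟨fun x => by rw [hz, mul_zero], fun _ => hz⟩
  intro k hk
  ext i j
  have h := fgA_eq n hn v k 0 i j
  rw [sub_zero] at h
  rw [← h, Matrix.zero_apply]
  have hnk : (n : ℤ) * k ≤ -n := by nlinarith
  obtain ⟨m, hm⟩ := Int.eq_ofNat_of_zero_le
    (show (0 : ℤ) ≤ (n * 0 + (j : ℕ)) - (n * k + (i : ℕ)) by
      have := j.2; have := i.2; omega)
  have := (main m).2 (by have := j.2; have := i.2; omega) (n * k + (i : ℕ))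
  rwa [← hm, add_sub_cancel] at this
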